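/- arXiv:1909.03923 — 4 statements merged into one kernel-verified Lean document; each statement's English description precedes it below -/
import Mathlib

section
/- Let V be a finite-dimensional real inner product space and let Λ ⊆ V be a set (the wave cone Λ_A of an operator A) with span Λ = V. Let p ∈ [1,∞) and let F : V → ℝ be Λ-convex, i.e. for every v ∈ V and λ ∈ Λ the function t ↦ F(v + tλ) is convex on ℝ, and suppose F satisfies the growth condition |F(v)| ≤ C(|v|^p + 1) for all v ∈ V. Then there is a constant C′ (depending only on C, p, and Λ) such that |F(v) − F(w)| ≤ C′ (1 + |v|^{p−1} + |w|^{p−1}) |v − w| for all v, w ∈ V. -/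
/-- A convex function on `ℝ` bounded by `B` on `[-T, T]` grows from `0` at rate at most `2B / T`. -/
theorem ConvexOn.abs_sub_zero_le_of_abs_le {f : ℝ → ℝ} (hf : ConvexOn ℝ Set.univ f) {T B t : ℝ}
    (hT : 0 < T) (hB : ∀ s, |s| ≤ T → |f s| ≤ B) (ht : |t| ≤ T) :
    |f t - f 0| ≤ |t| / T * (2 * B) := by
  obtain ⟨e, he, het⟩ : ∃ e : ℝ, |e| = T ∧ t = |t| / T * e := by
    rcases le_total 0 t with h | h
    · exact ⟨T, abs_of_pos hT, by rw [abs_of_nonneg h]; field_simp⟩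
    · exact ⟨-T, by rw [abs_neg, abs_of_pos hT], by rw [abs_of_nonpos h]; field_simp⟩
  have ha0 : 0 ≤ |t| / T := by positivity
  have ha1 : |t| / T ≤ 1 := by rwa [div_le_one hT]
  generalize |t| / T = a at *
  have hte : |t - e| ≤ T := by
    have : t - e = -((1 - a) * e) := by linear_combination het
    rw [this, abs_neg, abs_mul, he, abs_of_nonneg (by linarith)]
    nlinarith
  have upper := hf.2 (Set.mem_univ 0) (Set.mem_univ e) (sub_nonneg.2 ha1) ha0 (by ring)
  have lower := hf.2 (Set.mem_univ t) (Set.mem_univ (t - e)) (sub_nonneg.2 ha1) ha0 (by ring)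
  simp only [smul_eq_mul] at upper lower
  rw [show (1 - a) * 0 + a * e = t by linarith] at upper
  rw [show (1 - a) * t + a * (t - e) = 0 by linarith] at lower
  have h0 := abs_le.1 (hB 0 (by simpa using hT.le))
  have h1 := abs_le.1 (hB e he.le)
  have h2 := abs_le.1 (hB t ht)
  have h3 := abs_le.1 (hB _ hte)
  rw [abs_le]
  constructor <;> nlinarith

/-- A function that is convex along each direction `b i` and bounded by `B` on a large enough ball
is Lipschitz along sums of multiples of the `b i`. -/
theorem abs_sub_le_of_convexOn_directions {V ι : Type*} [NormedAddCommGroup V] [NormedSpace ℝ V]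
    {F : V → ℝ} {b : ι → V}
    (hF : ∀ v i, ConvexOn ℝ Set.univ (fun t : ℝ => F (v + t • b i)))
    {T B : ℝ} (hT : 0 < T) (v : V) {c : ι → ℝ} (hc : ∀ i, |c i| ≤ T) (s : Finset ι)
    (hB : ∀ x, ‖x‖ ≤ ‖v‖ + ∑ i ∈ s, T * ‖b i‖ → |F x| ≤ B) :
    |F (v + ∑ i ∈ s, c i • b i) - F v| ≤ ∑ i ∈ s, |c i| / T * (2 * B) := by
  classical
  induction s using Finset.induction_on with
  | empty => simp
  | insert j s hj ih =>
    rw [Finset.sum_insert hj] at hB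
    have hpos : 0 ≤ T * ‖b j‖ := by positivity
    have ih := ih fun x hx => hB x (by linarith)
    have hnorm : ‖∑ i ∈ s, c i • b i‖ ≤ ∑ i ∈ s, T * ‖b i‖ :=
      norm_sum_le_of_le _ fun i _ => by
        rw [norm_smul, Real.norm_eq_abs]
        exact mul_le_mul_of_nonneg_right (hc i) (norm_nonneg _)
    have step := (hF (v + ∑ i ∈ s, c i • b i) j).abs_sub_zero_le_of_abs_le (B := B) hT
      (fun r hr => hB _ (by
        have h1 := norm_add₃_le (a := v) (b := ∑ i ∈ s, c i • b i) (c := r • b j)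
        have h2 : ‖r • b j‖ ≤ T * ‖b j‖ := by
          rw [norm_smul, Real.norm_eq_abs]
          exact mul_le_mul_of_nonneg_right hr (norm_nonneg _)
        linarith)) (hc j)
    simp only [zero_smul, add_zero] at step
    rw [Finset.sum_insert hj, Finset.sum_insert hj, add_comm (c j • b j), ← add_assoc]
    exact (abs_sub_le _ _ _).trans (add_le_add step ih)

theorem Real.one_add_add_rpow_le {x y q : ℝ} (hx : 0 ≤ x) (hy : 0 ≤ y) (hq : 0 ≤ q) :
    (1 + x + y) ^ q ≤ 3 ^ q * (1 + x ^ q + y ^ q) := by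
  have key : ∀ m : ℝ, 0 ≤ m → 1 ≤ m → x ≤ m → y ≤ m → m ^ q ≤ 1 + x ^ q + y ^ q →
      (1 + x + y) ^ q ≤ 3 ^ q * (1 + x ^ q + y ^ q) := fun m hm h1 h2 h3 h4 =>
    calc (1 + x + y) ^ q ≤ (3 * m) ^ q :=
          Real.rpow_le_rpow (by positivity) (by linarith) hq
      _ = 3 ^ q * m ^ q := Real.mul_rpow (by norm_num) hm
      _ ≤ _ := by gcongr
  have hxq := Real.rpow_nonneg hx q
  have hyq := Real.rpow_nonneg hy q
  rcases le_total x y with hxy | hxy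
  · rcases le_total 1 y with h | h
    · exact key y hy h hxy le_rfl (by linarith)
    · exact key 1 zero_le_one le_rfl (hxy.trans h) h (by rw [Real.one_rpow]; linarith)
  · rcases le_total 1 x with h | h
    · exact key x hx h le_rfl hxy (by linarith)
    · exact key 1 zero_le_one le_rfl h (hxy.trans h) (by rw [Real.one_rpow]; linarith)

theorem Module.Basis.exists_abs_repr_le {V ι : Type*} [NormedAddCommGroup V] [NormedSpace ℝ V]
    [FiniteDimensional ℝ V] [Fintype ι] (b : Module.Basis ι ℝ V) :
    ∃ K : ℝ, 0 < K ∧ ∀ u i, |b.repr u i| ≤ K * ‖u‖ := by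
  obtain ⟨K, hK, h⟩ := (b.equivFunL : V →L[ℝ] (ι → ℝ)).bound
  exact ⟨K, hK, fun u i => (norm_le_pi_norm (b.equivFunL u) i).trans (h u)⟩

theorem stmt_7 {V : Type*}
    [NormedAddCommGroup V] [InnerProductSpace ℝ V] [FiniteDimensional ℝ V]
    (Λ : Set V) (hΛ : Submodule.span ℝ Λ = ⊤)
    (p : ℝ) (hp : 1 ≤ p) (C : ℝ) :
    ∃ C' : ℝ, 0 < C' ∧ ∀ F : V → ℝ,
      (∀ v : V, ∀ lam ∈ Λ, ConvexOn ℝ Set.univ (fun t : ℝ => F (v + t • lam))) →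
      (∀ v : V, |F v| ≤ C * (‖v‖ ^ p + 1)) →
      ∀ v w : V, |F v - F w| ≤ C' * (1 + ‖v‖ ^ (p - 1) + ‖w‖ ^ (p - 1)) * ‖v - w‖ := by
  obtain ⟨ι, _, b, hbΛ⟩ : ∃ (ι : Type _) (_ : Fintype ι) (b : Module.Basis ι ℝ V), ∀ i, b i ∈ Λ :=
    ⟨_, FiniteDimensional.fintypeBasisIndex (Module.Basis.ofSpan hΛ.ge),
      Module.Basis.ofSpan hΛ.ge, fun i => Module.Basis.ofSpan_subset hΛ.ge ⟨i, rfl⟩⟩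
  obtain ⟨K, hK, hrepr⟩ := b.exists_abs_repr_le
  set M : ℝ := 1 + K * ∑ i, ‖b i‖ with hM
  have hM0 : 0 ≤ M := by positivity
  set D : ℝ := Module.finrank ℝ V * (2 * (|C| * (M ^ p + 1))) with hD
  have hD0 : 0 ≤ D := by positivity
  refine ⟨D * 3 ^ (p - 1) + 1, by positivity, fun F hF hC v w => ?_⟩
  set R : ℝ := 1 + ‖v‖ + ‖w‖ with hR
  have hR1 : 1 ≤ R := by linarith [norm_nonneg v, norm_nonneg w]
  have hR0 : 0 < R := by linarith
  have hc : ∀ i, |b.repr (w - v) i| ≤ K * R := fun i => (hrepr _ i).trans <| by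
    gcongr
    linarith [norm_sub_le w v]
  have hB : ∀ x, ‖x‖ ≤ ‖v‖ + ∑ i, K * R * ‖b i‖ → |F x| ≤ |C| * (M ^ p + 1) * R ^ p := by
    intro x hx
    have hxM : ‖x‖ ≤ M * R := by
      rw [← Finset.mul_sum] at hx
      rw [hM]
      linarith [norm_nonneg w]
    calc |F x| ≤ C * (‖x‖ ^ p + 1) := hC x
      _ ≤ |C| * ((M * R) ^ p + R ^ p) := by
        gcongr
        · exact le_abs_self C
        · exact Real.one_le_rpow hR1 (by linarith)
      _ = _ := by rw [Real.mul_rpow hM0 hR0.le]; ring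
  have main := abs_sub_le_of_convexOn_directions (fun x i => hF x _ (hbΛ i)) (mul_pos hK hR0) v hc
    Finset.univ hB
  rw [b.sum_repr, add_sub_cancel, abs_sub_comm] at main
  calc |F v - F w|
      ≤ ∑ i, |b.repr (w - v) i| / (K * R) * (2 * (|C| * (M ^ p + 1) * R ^ p)) := main
    _ ≤ ∑ _i : ι, K * ‖w - v‖ / (K * R) * (2 * (|C| * (M ^ p + 1) * R ^ p)) :=
        Finset.sum_le_sum fun i _ => by gcongr; exact hrepr _ i
    _ = D * R ^ (p - 1) * ‖v - w‖ := by
        rw [Finset.sum_const, Finset.card_univ, ← Module.finrank_eq_card_basis b, nsmul_eq_mul,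
          norm_sub_rev w v, Real.rpow_sub_one hR0.ne', hD]
        field_simp
    _ ≤ D * (3 ^ (p - 1) * (1 + ‖v‖ ^ (p - 1) + ‖w‖ ^ (p - 1))) * ‖v - w‖ := by
        gcongr
        exact Real.one_add_add_rpow_le (norm_nonneg v) (norm_nonneg w) (by linarith)
    _ ≤ (D * 3 ^ (p - 1) + 1) * (1 + ‖v‖ ^ (p - 1) + ‖w‖ ^ (p - 1)) * ‖v - w‖ := by
        rw [← mul_assoc]
        gcongr
        linarith
end

section
/- Let n ≥ 2 and let H : M_n(ℝ) → ℝ be a linear combination of 2×2 minors: H(X) = ∑_{(I,J)} c_{I,J} det X[I,J], where the sum runs over all pairs (I,J) of two-element subsets I = {i₁ < i₂}, J = {j₁ < j₂} of {1,…,n}, X[I,J] denotes the 2×2 submatrix (x_{i,j})_{i∈I, j∈J}, and c_{I,J} ∈ ℝ. If H(X) = H((X + Xᵀ)/2) for every X ∈ M_n(ℝ), then H(X) = 0 for all X (equivalently, all coefficients c_{I,J} vanish). -/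
/-- The polarization of a `2 × 2` minor: the symmetric bilinear form associated with the
quadratic form `X ↦ X i₁ j₁ * X i₂ j₂ - X i₁ j₂ * X i₂ j₁`. -/
def minorPolar {ι : Type*} (i₁ i₂ j₁ j₂ : ι) (X Y : Matrix ι ι ℝ) : ℝ :=
  X i₁ j₁ * Y i₂ j₂ + Y i₁ j₁ * X i₂ j₂ - X i₁ j₂ * Y i₂ j₁ - Y i₁ j₂ * X i₂ j₁

open Matrix in
/-- A bilinear form on matrices which is invariant under transposing its first argument, and which
is alternating in the left factors of rank-one matrices, vanishes. -/
theorem bilin_eq_zero_of_transpose_of_alternating {ι : Type*} [Fintype ι] [DecidableEq ι]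
    (B : Matrix ι ι ℝ →ₗ[ℝ] Matrix ι ι ℝ →ₗ[ℝ] ℝ)
    (htr : ∀ X Y, B Xᵀ Y = B X Y)
    (halt : ∀ a b c d : ι → ℝ,
      B (vecMulVec a b) (vecMulVec c d) = -B (vecMulVec c b) (vecMulVec a d)) :
    B = 0 := by
  have hswap : ∀ a b c d : ι → ℝ,
      B (vecMulVec a b) (vecMulVec c d) = B (vecMulVec b a) (vecMulVec c d) := fun a b c d => by
    rw [← htr, transpose_vecMulVec]
  have hzero : ∀ a b c d : ι → ℝ, B (vecMulVec a b) (vecMulVec c d) = 0 := fun a b c d => by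
    linarith [hswap a b c d, halt b a c d, hswap c a b d, halt a c b d, hswap b c a d,
      halt c b a d]
  refine (stdBasis ℝ ι ι).ext fun ⟨i, j⟩ => (stdBasis ℝ ι ι).ext fun ⟨k, l⟩ => ?_
  simpa [stdBasis_eq_single, single_eq_single_vecMulVec_single] using
    hzero (Pi.single i 1) (Pi.single j 1) (Pi.single k 1) (Pi.single l 1)

/- STATEMENT 16: If `H : M_n(ℝ) → ℝ` is a linear combination of `2×2` minors and
`H(X) = H((X + Xᵀ)/2)` for every `X`, then `H ≡ 0`. -/

open Matrix in
theorem stmt_16 (n : ℕ) (hn : 2 ≤ n)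
    (c : Fin n → Fin n → Fin n → Fin n → ℝ)
    (H : Matrix (Fin n) (Fin n) ℝ → ℝ)
    (hH : ∀ X : Matrix (Fin n) (Fin n) ℝ,
      H X = ∑ i₁ : Fin n, ∑ i₂ : Fin n, ∑ j₁ : Fin n, ∑ j₂ : Fin n,
        if i₁ < i₂ ∧ j₁ < j₂ then
          c i₁ i₂ j₁ j₂ * (X i₁ j₁ * X i₂ j₂ - X i₁ j₂ * X i₂ j₁)
        else 0)
    (hsym : ∀ X : Matrix (Fin n) (Fin n) ℝ, H X = H ((2 : ℝ)⁻¹ • (X + Xᵀ))) :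
    ∀ X : Matrix (Fin n) (Fin n) ℝ, H X = 0 := by
  let b : Matrix (Fin n) (Fin n) ℝ → Matrix (Fin n) (Fin n) ℝ → ℝ := fun X Y =>
    ∑ i₁ : Fin n, ∑ i₂ : Fin n, ∑ j₁ : Fin n, ∑ j₂ : Fin n,
      if i₁ < i₂ ∧ j₁ < j₂ then c i₁ i₂ j₁ j₂ * minorPolar i₁ i₂ j₁ j₂ X Y else 0
  have hbH : ∀ X Y, b X Y = H (X + Y) - H X - H Y := fun X Y => by
    simp only [b, hH, ← Finset.sum_sub_distrib]
    congr! 4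
    split_ifs
    · simp only [minorPolar, Matrix.add_apply]; ring
    · ring
  have hcomm : ∀ X Y, b X Y = b Y X := fun X Y => by
    rw [hbH, hbH, add_comm X Y]; ring
  have hadd : ∀ X X' Y, b (X + X') Y = b X Y + b X' Y := fun X X' Y => by
    simp only [b, ← Finset.sum_add_distrib]
    congr! 4
    split_ifs
    · simp only [minorPolar, Matrix.add_apply]; ring
    · ring
  have hsmul : ∀ (r : ℝ) X Y, b (r • X) Y = r • b X Y := fun r X Y => by
    simp only [b, smul_eq_mul, Finset.mul_sum]
    congr! 4
    split_ifs
    · simp only [minorPolar, Matrix.smul_apply, smul_eq_mul]; ring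
    · ring
  let B : Matrix (Fin n) (Fin n) ℝ →ₗ[ℝ] Matrix (Fin n) (Fin n) ℝ →ₗ[ℝ] ℝ :=
    LinearMap.mk₂ ℝ b hadd hsmul
      (fun X Y Y' => by rw [hcomm, hadd, hcomm Y, hcomm Y'])
      (fun r X Y => by rw [hcomm, hsmul, hcomm Y])
  have hHtr : ∀ X Y, H (Xᵀ + Y) = H (X + Y) := fun X Y => by
    rw [hsym (Xᵀ + Y), hsym (X + Y)]
    congr 2
    simp only [transpose_add, transpose_transpose]
    abel
  have hH0 : H 0 = 0 := by simp [hH]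
  have hB : B = 0 := by
    refine bilin_eq_zero_of_transpose_of_alternating B (fun X Y => ?_) (fun u v w z => ?_)
    · have h := hHtr X 0
      rw [add_zero, add_zero] at h
      simp only [B, LinearMap.mk₂_apply, hbH, hHtr, h]
    · simp only [B, LinearMap.mk₂_apply, b, ← Finset.sum_neg_distrib]
      congr! 4
      split_ifs
      · simp only [minorPolar, vecMulVec_apply]; ring
      · ring
  intro X
  have h : b X (-X) = 0 := congrArg (fun L => L X (-X)) hB
  have hneg : H (-X) = H X := by simp [hH]
  rw [hbH, add_neg_cancel, hH0, hneg] at h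
  linarith
end

section
/- Let H : M₃(ℝ) → ℝ be a linear combination of 2×2 minors: H(X) = ∑_{(I,J)} c_{I,J} det X[I,J], where the sum runs over all pairs (I,J) of two-element subsets of {1,2,3} and X[I,J] is the corresponding 2×2 submatrix. If H(X) = H((X − Xᵀ)/2) for every X ∈ M₃(ℝ), then H(X) = 0 for all X. -/
open Matrix in
/-- In dimension three every matrix has the same antisymmetric part as some matrix
of rank at most one. -/
theorem exists_vecMulVec_sub_transpose_eq {K : Type*} [Field K] (X : Matrix (Fin 3) (Fin 3) K) :
    ∃ a b : Fin 3 → K, X - Xᵀ = vecMulVec a b - (vecMulVec a b)ᵀ := by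
  by_cases hp : X 0 1 - X 1 0 = 0
  · refine ⟨![X 0 2 - X 2 0, X 1 2 - X 2 1, 0], ![0, 0, 1], ?_⟩
    have hp' : X 1 0 - X 0 1 = 0 := by linear_combination -hp
    ext i j
    fin_cases i <;> fin_cases j <;> simp [hp, hp']
  · refine ⟨![1, 0, -(X 1 2 - X 2 1) / (X 0 1 - X 1 0)],
      ![0, X 0 1 - X 1 0, X 0 2 - X 2 0], ?_⟩
    ext i j
    fin_cases i <;> fin_cases j <;> simp [hp]

/- STATEMENT 17: If `H : M₃(ℝ) → ℝ` is a linear combination of `2×2` minors and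
`H(X) = H((X − Xᵀ)/2)` for every `X`, then `H ≡ 0`. -/

open Matrix in
theorem stmt_17
    (c : Fin 3 → Fin 3 → Fin 3 → Fin 3 → ℝ)
    (H : Matrix (Fin 3) (Fin 3) ℝ → ℝ)
    (hH : ∀ X : Matrix (Fin 3) (Fin 3) ℝ,
      H X = ∑ i₁ : Fin 3, ∑ i₂ : Fin 3, ∑ j₁ : Fin 3, ∑ j₂ : Fin 3,
        if i₁ < i₂ ∧ j₁ < j₂ then
          c i₁ i₂ j₁ j₂ * (X i₁ j₁ * X i₂ j₂ - X i₁ j₂ * X i₂ j₁)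
        else 0)
    (hasym : ∀ X : Matrix (Fin 3) (Fin 3) ℝ, H X = H ((2 : ℝ)⁻¹ • (X - Xᵀ))) :
    ∀ X : Matrix (Fin 3) (Fin 3) ℝ, H X = 0 := by
  intro X
  have rank_one (a b : Fin 3 → ℝ) : H (vecMulVec a b) = 0 := by
    rw [hH]
    refine Finset.sum_eq_zero fun i₁ _ => Finset.sum_eq_zero fun i₂ _ =>
      Finset.sum_eq_zero fun j₁ _ => Finset.sum_eq_zero fun j₂ _ => ?_
    split_ifs
    · simp only [vecMulVec_apply]
      ring
    · rfl
  obtain ⟨a, b, hab⟩ := exists_vecMulVec_sub_transpose_eq X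
  rw [hasym, hab, ← hasym, rank_one]
end

section
/- Let s ≥ 2 and n ≥ s be integers, let p ∈ (s−1, ∞) and q ∈ (1, ∞) satisfy (s−1)/p + 1/q = 1. There exists a constant C (depending on n, s, p) such that for all f, g ∈ C_c^∞(ℝ^n, ℝ^s) and all φ ∈ C_c^∞(ℝ^n), | ∫_{ℝ^n} φ(x) ( det D′f(x) − det D′g(x) ) dx | ≤ C ‖f − g‖_{L^q(ℝ^n)} ( ‖D′f‖_{L^p(ℝ^n)} + ‖D′g‖_{L^p(ℝ^n)} )^{s−1} ‖Dφ‖_{L^∞(ℝ^n)}, where D′f(x) denotes the s×s matrix (∂f_i/∂x_j(x))_{1 ≤ i,j ≤ s} of partial derivatives with respect to the first s coordinates. -/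
/- STATEMENT 18: Quantitative Jacobian estimate. For `s ≥ 2`, `n ≥ s`, `p ∈ (s−1,∞)`,
`q ∈ (1,∞)` with `(s−1)/p + 1/q = 1`, there is a constant `C` such that for all
`f, g ∈ C_c^∞(ℝ^n, ℝ^s)` and `φ ∈ C_c^∞(ℝ^n)`,
`|∫ φ (det D′f − det D′g)| ≤ C ‖f−g‖_{L^q} (‖D′f‖_{L^p} + ‖D′g‖_{L^p})^{s−1} ‖Dφ‖_{L^∞}`,
where `D′f` is the `s×s` matrix of partials with respect to the first `s` coordinates. -/

open MeasureTheory
open scoped ContDiff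

/-- The `s×s` matrix `D′f(x) = (∂ f_i/∂ x_j (x))_{1 ≤ i,j ≤ s}` of partial derivatives of
`f : ℝ^n → ℝ^s` with respect to the first `s` coordinates. -/
noncomputable def Dprime {n s : ℕ} (hsn : s ≤ n) (f : (Fin n → ℝ) → (Fin s → ℝ))
    (x : Fin n → ℝ) : Matrix (Fin s) (Fin s) ℝ :=
  fun i j => fderiv ℝ (fun y => f y i) x (Pi.single (Fin.castLE hsn j) 1)

/-- A Euclidean-type norm on square matrices. -/
noncomputable def mnorm {s : ℕ} (M : Matrix (Fin s) (Fin s) ℝ) : ℝ :=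
  Real.sqrt (∑ i, ∑ j, (M i j) ^ 2)

section Jacobian

variable {ι E : Type*} [DecidableEq ι] [NormedAddCommGroup E] [NormedSpace ℝ E]

/-- The matrix of the derivatives of the functions `h i` in the directions `e j`. -/
noncomputable def jacobianMatrix (e : ι → E) (h : ι → E → ℝ) (x : E) : Matrix ι ι ℝ :=
  Matrix.of fun i j => fderiv ℝ (h i) x (e j)

theorem jacobianMatrix_update (e : ι → E) (h : ι → E → ℝ) (k : ι) (u : E → ℝ) (x : E) :
    jacobianMatrix e (Function.update h k u) x =
      (jacobianMatrix e h x).updateRow k fun j => fderiv ℝ u x (e j) := by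
  ext i j
  rcases eq_or_ne i k with rfl | hi
  · simp [jacobianMatrix]
  · simp [jacobianMatrix, hi]

variable [Fintype ι]

theorem det_eq_sum_prod_erase (M : Matrix ι ι ℝ) (k : ι) :
    M.det = ∑ σ : Equiv.Perm ι, (Equiv.Perm.sign σ : ℝ) *
      ((∏ i ∈ Finset.univ.erase k, M i (σ i)) * M k (σ k)) := by
  rw [← Matrix.det_transpose, Matrix.det_apply']
  refine Finset.sum_congr rfl fun σ _ => ?_
  rw [Finset.prod_erase_mul _ _ (Finset.mem_univ k)]
  rfl

/-- Antisymmetrizing a product containing a factor symmetric in two of the indices gives zero. -/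
theorem sum_sign_mul_symmetric_eq_zero (M : Matrix ι ι ℝ) (S : ι → ι → ℝ)
    (hS : ∀ a b, S a b = S b a) {k l : ι} (hkl : l ≠ k) :
    ∑ σ : Equiv.Perm ι, (Equiv.Perm.sign σ : ℝ) *
      ((∏ i ∈ (Finset.univ.erase k).erase l, M i (σ i)) * S (σ k) (σ l)) = 0 := by
  set F : Equiv.Perm ι → ℝ := fun σ => (Equiv.Perm.sign σ : ℝ) *
      ((∏ i ∈ (Finset.univ.erase k).erase l, M i (σ i)) * S (σ k) (σ l))
  have hneg : ∀ σ, F (σ * Equiv.swap k l) = -F σ := by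
    intro σ
    have hprod : ∏ i ∈ (Finset.univ.erase k).erase l, M i ((σ * Equiv.swap k l) i) =
        ∏ i ∈ (Finset.univ.erase k).erase l, M i (σ i) := by
      refine Finset.prod_congr rfl fun i hi => ?_
      simp only [Finset.mem_erase, Finset.mem_univ, and_true] at hi
      rw [Equiv.Perm.mul_apply, Equiv.swap_apply_of_ne_of_ne hi.2 hi.1]
    simp only [F, hprod]
    simp [Equiv.Perm.sign_mul, Equiv.Perm.sign_swap hkl.symm, hS (σ l) (σ k)]
  have hsum : ∑ σ, F σ = -∑ σ, F σ := by
    rw [← Finset.sum_neg_distrib, ← Equiv.sum_comp (Equiv.mulRight (Equiv.swap k l)) F]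
    exact Finset.sum_congr rfl fun σ _ => hneg σ
  change ∑ σ, F σ = 0
  linarith

theorem abs_det_le_of_row_le (M : Matrix ι ι ℝ) (k : ι) {a b : ℝ}
    (hk : ∀ j, |M k j| ≤ b) (hM : ∀ i ≠ k, ∀ j, |M i j| ≤ a) :
    |M.det| ≤ (Fintype.card ι).factorial * (a ^ (Fintype.card ι - 1) * b) := by
  rw [det_eq_sum_prod_erase M k]
  refine (Finset.abs_sum_le_sum_abs _ _).trans ?_
  have hterm : ∀ σ : Equiv.Perm ι, |(Equiv.Perm.sign σ : ℝ) *
      ((∏ i ∈ Finset.univ.erase k, M i (σ i)) * M k (σ k))| ≤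
      a ^ (Fintype.card ι - 1) * b := by
    intro σ
    have hsign : |((Equiv.Perm.sign σ : ℤ) : ℝ)| = 1 := by
      rcases Int.units_eq_one_or (Equiv.Perm.sign σ) with h | h <;> simp [h]
    have hprod : ∏ i ∈ Finset.univ.erase k, |M i (σ i)| ≤ a ^ (Fintype.card ι - 1) := by
      refine (Finset.prod_le_prod (fun i _ => abs_nonneg _)
        (fun i hi => hM i (Finset.ne_of_mem_erase hi) (σ i))).trans_eq ?_
      rw [Finset.prod_const, Finset.card_erase_of_mem (Finset.mem_univ k), Finset.card_univ]
    rw [abs_mul, hsign, one_mul, abs_mul, Finset.abs_prod]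
    exact mul_le_mul hprod (hk _) (abs_nonneg _)
      ((Finset.prod_nonneg fun i _ => abs_nonneg _).trans hprod)
  refine (Finset.sum_le_sum fun σ _ => hterm σ).trans_eq ?_
  rw [Finset.sum_const, Finset.card_univ, Fintype.card_perm, nsmul_eq_mul]

theorem contDiff_fderiv_apply_const {u : E → ℝ} (hu : ContDiff ℝ ∞ u) (v : E) :
    ContDiff ℝ ∞ fun x => fderiv ℝ u x v :=
  (hu.fderiv_right (m := ∞) (by simp)).clm_apply contDiff_const

theorem continuous_det_jacobianMatrix (e : ι → E) {h : ι → E → ℝ}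
    (hh : ∀ i, ContDiff ℝ ∞ (h i)) : Continuous fun x => (jacobianMatrix e h x).det :=
  Continuous.matrix_det (continuous_matrix fun i j =>
    (contDiff_fderiv_apply_const (hh i) (e j)).continuous)

/-- The minors of a gradient are divergences: the sum over permutations of the terms produced by
integrating by parts in one row vanishes. -/
theorem sum_sign_mul_fderiv_prod_eq_zero (e : ι → E) {h : ι → E → ℝ}
    (hh : ∀ i, ContDiff ℝ ∞ (h i)) (k : ι) (x : E) :
    ∑ σ : Equiv.Perm ι, (Equiv.Perm.sign σ : ℝ) *
      fderiv ℝ (fun y => ∏ i ∈ Finset.univ.erase k, fderiv ℝ (h i) y (e (σ i))) x (e (σ k)) =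
        0 := by
  have hsnd : ∀ l v w, fderiv ℝ (fun y => fderiv ℝ (h l) y v) x w =
      fderiv ℝ (fderiv ℝ (h l)) x w v := by
    intro l v w
    have hd : DifferentiableAt ℝ (fderiv ℝ (h l)) x :=
      ((hh l).fderiv_right (m := ∞) (by simp)).differentiable (by simp) x
    rw [fderiv_clm_apply hd (differentiableAt_const v)]
    simp
  have hsymm : ∀ l, IsSymmSndFDerivAt ℝ (h l) x := fun l =>
    (hh l).contDiffAt.isSymmSndFDerivAt (by
      rw [minSmoothness_of_isRCLikeNormedField]
      exact WithTop.coe_le_coe.2 le_top)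
  have hprod : ∀ σ : Equiv.Perm ι,
      fderiv ℝ (fun y => ∏ i ∈ Finset.univ.erase k, fderiv ℝ (h i) y (e (σ i))) x (e (σ k)) =
      ∑ l ∈ Finset.univ.erase k, (∏ i ∈ (Finset.univ.erase k).erase l,
        fderiv ℝ (h i) x (e (σ i))) * fderiv ℝ (fderiv ℝ (h l)) x (e (σ k)) (e (σ l)) := by
    intro σ
    rw [(HasFDerivAt.finsetProd fun i _ => ((contDiff_fderiv_apply_const (hh i)
      (e (σ i))).differentiable (by simp) x).hasFDerivAt).fderiv]
    simp [hsnd]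
  simp only [hprod, Finset.mul_sum]
  rw [Finset.sum_comm]
  refine Finset.sum_eq_zero fun l hl => ?_
  exact sum_sign_mul_symmetric_eq_zero (jacobianMatrix e h x)
    (fun a b => fderiv ℝ (fderiv ℝ (h l)) x (e a) (e b))
    (fun a b => hsymm l (e a) (e b)) (Finset.ne_of_mem_erase hl)

variable [FiniteDimensional ℝ E] [MeasurableSpace E] [BorelSpace E]
  (μ : Measure E) [μ.IsAddHaarMeasure]

/-- The integral of a Jacobian determinant vanishes if one component has compact support. -/
theorem integral_det_jacobianMatrix_eq_zero (e : ι → E) {h : ι → E → ℝ}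
    (hh : ∀ i, ContDiff ℝ ∞ (h i)) (k : ι) (hk : HasCompactSupport (h k)) :
    ∫ x, (jacobianMatrix e h x).det ∂μ = 0 := by
  set P : Equiv.Perm ι → E → ℝ :=
    fun σ y => ∏ i ∈ Finset.univ.erase k, fderiv ℝ (h i) y (e (σ i)) with hP
  have hPs : ∀ σ, ContDiff ℝ ∞ (P σ) := fun σ =>
    contDiff_prod fun i _ => contDiff_fderiv_apply_const (hh i) (e (σ i))
  have hInt : ∀ σ, Integrable (fun x => P σ x * fderiv ℝ (h k) x (e (σ k))) μ := fun σ =>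
    ((hPs σ).continuous.mul
      (contDiff_fderiv_apply_const (hh k) _).continuous).integrable_of_hasCompactSupport
      (hk.fderiv_apply (𝕜 := ℝ) (e (σ k))).mul_left
  have hInt' : ∀ σ, Integrable (fun x => fderiv ℝ (P σ) x (e (σ k)) * h k x) μ := fun σ =>
    ((contDiff_fderiv_apply_const (hPs σ) _).continuous.mul
      (hh k).continuous).integrable_of_hasCompactSupport hk.mul_left
  have hparts : ∀ σ, ∫ x, P σ x * fderiv ℝ (h k) x (e (σ k)) ∂μ =
      -∫ x, fderiv ℝ (P σ) x (e (σ k)) * h k x ∂μ := fun σ =>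
    integral_mul_fderiv_eq_neg_fderiv_mul_of_integrable (hInt' σ) (hInt σ)
      (((hPs σ).continuous.mul (hh k).continuous).integrable_of_hasCompactSupport hk.mul_left)
      (fun x _ => (hPs σ).differentiable (by simp) x)
      (fun x _ => (hh k).differentiable (by simp) x)
  calc ∫ x, (jacobianMatrix e h x).det ∂μ
      = ∫ x, ∑ σ : Equiv.Perm ι, (Equiv.Perm.sign σ : ℝ) *
          (P σ x * fderiv ℝ (h k) x (e (σ k))) ∂μ :=
        integral_congr_ae (.of_forall fun x => det_eq_sum_prod_erase _ k)
    _ = ∑ σ : Equiv.Perm ι, (Equiv.Perm.sign σ : ℝ) *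
          -∫ x, fderiv ℝ (P σ) x (e (σ k)) * h k x ∂μ := by
        rw [integral_finsetSum _ fun σ _ => (hInt σ).const_mul _]
        exact Finset.sum_congr rfl fun σ _ => by rw [integral_const_mul, hparts]
    _ = -∫ x, (∑ σ : Equiv.Perm ι, (Equiv.Perm.sign σ : ℝ) *
          fderiv ℝ (P σ) x (e (σ k))) * h k x ∂μ := by
        simp only [Finset.sum_mul, mul_assoc]
        rw [integral_finsetSum _ fun σ _ => (hInt' σ).const_mul _, ← Finset.sum_neg_distrib]
        exact Finset.sum_congr rfl fun σ _ => by rw [integral_const_mul, mul_neg]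
    _ = 0 := by
        simp [hP, sum_sign_mul_fderiv_prod_eq_zero e hh k]

/-- Integration by parts for Jacobian determinants: a test function may be exchanged with one of
the components. -/
theorem integral_mul_det_jacobianMatrix (e : ι → E) {h : ι → E → ℝ}
    (hh : ∀ i, ContDiff ℝ ∞ (h i)) (k : ι) {φ : E → ℝ} (hφ : ContDiff ℝ ∞ φ)
    (hφc : HasCompactSupport φ) (hk : HasCompactSupport (h k)) :
    ∫ x, φ x * (jacobianMatrix e h x).det ∂μ =
      -∫ x, h k x * (jacobianMatrix e (Function.update h k φ) x).det ∂μ := by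
  have hupd : ∀ u : E → ℝ, ContDiff ℝ ∞ u → ∀ i, ContDiff ℝ ∞ (Function.update h k u i) := by
    intro u hu i
    rcases eq_or_ne i k with rfl | hi
    · simpa using hu
    · simpa [hi] using hh i
  have hpt : ∀ x, (jacobianMatrix e (Function.update h k fun y => φ y * h k y) x).det =
      φ x * (jacobianMatrix e h x).det +
        h k x * (jacobianMatrix e (Function.update h k φ) x).det := by
    intro x
    have hrow : (fun j => fderiv ℝ (fun y => φ y * h k y) x (e j)) =
        φ x • (jacobianMatrix e h x k) + h k x • fun j => fderiv ℝ φ x (e j) := by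
      ext j
      rw [fderiv_fun_mul (hφ.differentiable (by simp) x) ((hh k).differentiable (by simp) x)]
      simp [jacobianMatrix]
    rw [jacobianMatrix_update, jacobianMatrix_update, hrow, Matrix.det_updateRow_add,
      Matrix.det_updateRow_smul, Matrix.det_updateRow_smul, Matrix.updateRow_eq_self]
  have hzero := integral_det_jacobianMatrix_eq_zero μ e
    (hupd (fun y => φ y * h k y) (hφ.mul (hh k))) k (by
      rw [Function.update_self]
      exact hφc.mul_right)
  simp only [hpt] at hzero
  rw [integral_add] at hzero
  · linarith
  · exact (hφ.continuous.mul
      (continuous_det_jacobianMatrix e hh)).integrable_of_hasCompactSupport hφc.mul_right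
  · exact ((hh k).continuous.mul (continuous_det_jacobianMatrix e
      (hupd φ hφ))).integrable_of_hasCompactSupport hk.mul_right

end Jacobian

/-- Hölder's inequality for one function in `L^q` and `m` factors in `L^p`. -/
theorem integral_norm_mul_add_pow_le {α V : Type*} [MeasurableSpace α] [NormedAddCommGroup V]
    (μ : Measure α) {u : α → V} {F G : α → ℝ} {m : ℕ} (hm : 1 ≤ m) {p q : ℝ} (hp : (m : ℝ) < p)
    (hq : 1 < q) (hpq : (m : ℝ) / p + 1 / q = 1) (hu : MemLp u (ENNReal.ofReal q) μ)
    (hF : MemLp F (ENNReal.ofReal p) μ) (hG : MemLp G (ENNReal.ofReal p) μ)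
    (hF0 : ∀ x, 0 ≤ F x) (hG0 : ∀ x, 0 ≤ G x) :
    Integrable (fun x => ‖u x‖ * (F x + G x) ^ m) μ ∧
    ∫ x, ‖u x‖ * (F x + G x) ^ m ∂μ ≤ (eLpNorm u (ENNReal.ofReal q) μ).toReal *
      ((eLpNorm F (ENNReal.ofReal p) μ).toReal + (eLpNorm G (ENNReal.ofReal p) μ).toReal) ^ m := by
  have hm0 : (0 : ℝ) < m := by exact_mod_cast hm
  have hm1 : (1 : ℝ) ≤ m := by exact_mod_cast hm
  have hp0 : 0 < p := hm0.trans hp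
  have hconj : q.HolderConjugate (p / m) := by
    rw [Real.holderConjugate_iff]
    refine ⟨hq, ?_⟩
    rw [inv_div, ← one_div]
    linarith
  have hhold : (ENNReal.ofReal q).HolderConjugate (ENNReal.ofReal (p / m)) :=
    hconj.ennrealOfReal
  have hexp : ENNReal.ofReal (p / m) * ENNReal.ofReal m = ENNReal.ofReal p := by
    rw [← ENNReal.ofReal_mul (by positivity), div_mul_cancel₀ _ hm0.ne']
  have heq : (fun x => ‖u x‖ * (F x + G x) ^ m) =
      (fun x => ‖u x‖) • fun x => ‖(F + G) x‖ ^ (m : ℝ) := by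
    ext x
    simp [abs_of_nonneg (add_nonneg (hF0 x) (hG0 x))]
  have hmeas : AEStronglyMeasurable (fun x => ‖(F + G) x‖ ^ (m : ℝ)) μ :=
    ((hF.add hG).aestronglyMeasurable.norm.aemeasurable.pow_const _).aestronglyMeasurable
  have hle : eLpNorm (fun x => ‖u x‖ * (F x + G x) ^ m) 1 μ ≤
      eLpNorm u (ENNReal.ofReal q) μ *
        (eLpNorm F (ENNReal.ofReal p) μ + eLpNorm G (ENNReal.ofReal p) μ) ^ m := by
    rw [heq]
    refine (eLpNorm_smul_le_mul_eLpNorm (p := ENNReal.ofReal q) (q := ENNReal.ofReal (p / m))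
      hmeas hu.aestronglyMeasurable.norm).trans ?_
    rw [eLpNorm_norm, eLpNorm_norm_rpow _ hm0, hexp, ENNReal.rpow_natCast]
    gcongr
    exact eLpNorm_add_le hF.aestronglyMeasurable hG.aestronglyMeasurable
      (by rw [← ENNReal.ofReal_one]; exact ENNReal.ofReal_le_ofReal (hm1.trans hp.le))
  have hfin : eLpNorm u (ENNReal.ofReal q) μ *
        (eLpNorm F (ENNReal.ofReal p) μ + eLpNorm G (ENNReal.ofReal p) μ) ^ m ≠ ⊤ :=
    ENNReal.mul_ne_top hu.eLpNorm_ne_top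
      (ENNReal.pow_ne_top (ENNReal.add_ne_top.2 ⟨hF.eLpNorm_ne_top, hG.eLpNorm_ne_top⟩))
  refine ⟨memLp_one_iff_integrable.1
    ⟨heq ▸ hu.aestronglyMeasurable.norm.smul hmeas, hle.trans_lt hfin.lt_top⟩, ?_⟩
  rw [← ENNReal.toReal_add hF.eLpNorm_ne_top hG.eLpNorm_ne_top, ← ENNReal.toReal_pow,
    ← ENNReal.toReal_mul]
  refine le_trans ?_ (ENNReal.toReal_mono hfin hle)
  rw [eLpNorm_one_eq_lintegral_enorm, ← integral_norm_eq_lintegral_enorm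
    (heq ▸ hu.aestronglyMeasurable.norm.smul hmeas)]
  exact (Real.le_norm_self _).trans (norm_integral_le_integral_norm _)

theorem abs_apply_le_mnorm {s : ℕ} (M : Matrix (Fin s) (Fin s) ℝ) (i j : Fin s) :
    |M i j| ≤ mnorm M := by
  refine Real.abs_le_sqrt ?_
  exact (Finset.single_le_sum (f := fun j => M i j ^ 2) (fun _ _ => sq_nonneg _)
    (Finset.mem_univ j)).trans (Finset.single_le_sum (f := fun i => ∑ j, M i j ^ 2)
      (fun _ _ => Finset.sum_nonneg fun _ _ => sq_nonneg _) (Finset.mem_univ i))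

theorem mnorm_nonneg {s : ℕ} (M : Matrix (Fin s) (Fin s) ℝ) : 0 ≤ mnorm M :=
  Real.sqrt_nonneg _

theorem hasCompactSupport_component {E : Type*} [TopologicalSpace E] {s : ℕ}
    {f : E → Fin s → ℝ} (hf : HasCompactSupport f) (i : Fin s) :
    HasCompactSupport fun x => f x i :=
  hf.comp_left (g := fun v : Fin s → ℝ => v i) rfl

theorem memLp_mnorm_Dprime {n s : ℕ} (hsn : s ≤ n) {f : (Fin n → ℝ) → (Fin s → ℝ)}
    (hf : ContDiff ℝ ∞ f) (hfc : HasCompactSupport f) (p : ENNReal) :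
    MemLp (fun x => mnorm (Dprime hsn f x)) p volume := by
  have hcont : Continuous fun x => mnorm (Dprime hsn f x) := by
    refine Real.continuous_sqrt.comp (continuous_finsetSum _ fun i _ =>
      continuous_finsetSum _ fun j _ => Continuous.pow ?_ 2)
    exact (contDiff_fderiv_apply_const (contDiff_pi.1 hf i) _).continuous
  refine hcont.memLp_of_hasCompactSupport (hfc.mono' fun x hx => ?_)
  by_contra hxf
  refine hx ?_
  have hzero : Dprime hsn f x = 0 := by
    ext i j
    have hi : x ∉ tsupport fun y => f y i :=
      fun h => hxf (closure_mono (fun y (hy : f y i ≠ 0) (h0 : f y = 0) => hy (by simp [h0])) h)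
    simp [Dprime, fderiv_of_notMem_tsupport ℝ hi]
  simp [hzero, mnorm]

/-- The difference of two determinants, telescoped by exchanging one row at a time. -/
theorem det_sub_det_eq_sum {ι : Type*} [Fintype ι] [LinearOrder ι] (A B : Matrix ι ι ℝ) :
    A.det - B.det = ∑ k, Matrix.det (Matrix.of fun i =>
      if i < k then A i else if i = k then A i - B i else B i) := by
  have h := MultilinearMap.map_piecewise_sub_map_piecewise
    (Matrix.detRowAlternating (n := ι) (R := ℝ)).toMultilinearMap
    (fun i => A i) (fun i => B i) (fun _ => 0) Finset.univ
  simp only [Finset.piecewise_univ, Finset.mem_univ, if_true] at h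
  exact h

theorem stmt_18 (n s : ℕ) (hs : 2 ≤ s) (hsn : s ≤ n)
    (p q : ℝ) (hp : (s : ℝ) - 1 < p) (hq : 1 < q)
    (hpq : ((s : ℝ) - 1) / p + 1 / q = 1) :
    ∃ C : ℝ, 0 < C ∧
      ∀ f g : (Fin n → ℝ) → (Fin s → ℝ), ∀ φ : (Fin n → ℝ) → ℝ,
        ContDiff ℝ ∞ f → HasCompactSupport f →
        ContDiff ℝ ∞ g → HasCompactSupport g →
        ContDiff ℝ ∞ φ → HasCompactSupport φ →
        |∫ x, φ x * ((Dprime hsn f x).det - (Dprime hsn g x).det)| ≤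
          C * (eLpNorm (fun x => f x - g x) (ENNReal.ofReal q) volume).toReal *
            ((eLpNorm (fun x => mnorm (Dprime hsn f x)) (ENNReal.ofReal p) volume).toReal +
              (eLpNorm (fun x => mnorm (Dprime hsn g x)) (ENNReal.ofReal p) volume).toReal)
              ^ (s - 1) *
            (eLpNorm (fun x => fderiv ℝ φ x) ⊤ volume).toReal := by
  refine ⟨s * s.factorial, by positivity, fun f g φ hf hfc hg hgc hφ hφc => ?_⟩
  have hcast : ((s - 1 : ℕ) : ℝ) = (s : ℝ) - 1 := by
    rw [Nat.cast_sub (by omega), Nat.cast_one]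
  set e : Fin s → Fin n → ℝ := fun j => Pi.single (Fin.castLE hsn j) 1 with he
  set h : Fin s → Fin s → (Fin n → ℝ) → ℝ := fun k i x =>
    if i < k then f x i else if i = k then f x i - g x i else g x i with hh
  set N := (eLpNorm (fun x => fderiv ℝ φ x) ⊤ volume).toReal
  set F : (Fin n → ℝ) → ℝ := fun x => mnorm (Dprime hsn f x)
  set G : (Fin n → ℝ) → ℝ := fun x => mnorm (Dprime hsn g x)
  have hfi := contDiff_pi.1 hf
  have hgi := contDiff_pi.1 hg
  have hsmooth : ∀ k i, ContDiff ℝ ∞ (h k i) := by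
    intro k i
    simp only [hh]
    split_ifs
    exacts [hfi i, (hfi i).sub (hgi i), hgi i]
  have hkk : ∀ k, h k k = fun x => f x k - g x k := fun k => by simp [hh]
  have hcomp : ∀ k, HasCompactSupport (h k k) := fun k => by
    rw [hkk]
    exact (hasCompactSupport_component hfc k).sub (hasCompactSupport_component hgc k)
  have htel : ∀ x, (Dprime hsn f x).det - (Dprime hsn g x).det =
      ∑ k, (jacobianMatrix e (h k) x).det := by
    intro x
    rw [det_sub_det_eq_sum]
    refine Finset.sum_congr rfl fun k _ => congrArg Matrix.det ?_
    ext i j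
    simp only [jacobianMatrix, Matrix.of_apply, hh]
    split_ifs
    · rfl
    · rw [fderiv_fun_sub ((hfi i).differentiable (by simp) x)
        ((hgi i).differentiable (by simp) x)]
      rfl
    · rfl
  have hφN : ∀ᵐ x, ‖fderiv ℝ φ x‖ ≤ N := by
    have hmem : MemLp (fun x => fderiv ℝ φ x) ⊤ volume :=
      (hφ.continuous_fderiv (by simp)).memLp_of_hasCompactSupport (hφc.fderiv (𝕜 := ℝ))
    filter_upwards [ae_le_eLpNormEssSup (f := fun x => fderiv ℝ φ x) (μ := volume)] with x hx
    rw [← eLpNorm_exponent_top] at hx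
    rw [← toReal_enorm]
    exact ENNReal.toReal_mono hmem.eLpNorm_ne_top hx
  have henorm : ∀ j, ‖e j‖ ≤ 1 := fun j => by
    simp only [he, Pi.norm_single, norm_one, le_refl]
  obtain ⟨hInt, hholder⟩ := integral_norm_mul_add_pow_le volume (u := fun x => f x - g x)
    (F := F) (G := G) (m := s - 1) (by omega) (by rwa [hcast]) hq (by rwa [hcast])
    ((hf.continuous.sub hg.continuous).memLp_of_hasCompactSupport (hfc.sub hgc))
    (memLp_mnorm_Dprime hsn hf hfc _) (memLp_mnorm_Dprime hsn hg hgc _)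
    (fun _ => mnorm_nonneg _) (fun _ => mnorm_nonneg _)
  have hterm : ∀ k, |∫ x, φ x * (jacobianMatrix e (h k) x).det| ≤
      s.factorial * N * ∫ x, ‖f x - g x‖ * (F x + G x) ^ (s - 1) := by
    intro k
    rw [integral_mul_det_jacobianMatrix volume e (hsmooth k) k hφ hφc (hcomp k), abs_neg,
      ← integral_const_mul, ← Real.norm_eq_abs]
    refine norm_integral_le_of_norm_le (hInt.const_mul _) ?_
    filter_upwards [hφN] with x hx
    have hdet := abs_det_le_of_row_le (jacobianMatrix e (Function.update (h k) k φ) x) k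
      (a := F x + G x) (b := N) (fun j => by
        simp only [jacobianMatrix, Matrix.of_apply, Function.update_self]
        exact ((fderiv ℝ φ x).le_opNorm (e j)).trans
          ((mul_le_of_le_one_right (norm_nonneg _) (henorm j)).trans hx))
      (fun i hi j => by
        have hFij := abs_apply_le_mnorm (Dprime hsn f x) i j
        have hGij := abs_apply_le_mnorm (Dprime hsn g x) i j
        have hF0 := mnorm_nonneg (Dprime hsn f x)
        have hG0 := mnorm_nonneg (Dprime hsn g x)
        simp only [jacobianMatrix, Matrix.of_apply, Function.update_of_ne hi, hh, hi, if_false]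
        split_ifs
        · exact hFij.trans (le_add_of_nonneg_right hG0)
        · exact hGij.trans (le_add_of_nonneg_left hF0))
    rw [Fintype.card_fin] at hdet
    have hu : |h k k x| ≤ ‖f x - g x‖ := by
      rw [hkk]
      exact norm_le_pi_norm (f x - g x) k
    rw [Real.norm_eq_abs, abs_mul]
    refine (mul_le_mul hu hdet (abs_nonneg _) (norm_nonneg _)).trans_eq ?_
    ring
  have hsum : ∫ x, φ x * ((Dprime hsn f x).det - (Dprime hsn g x).det) =
      ∑ k, ∫ x, φ x * (jacobianMatrix e (h k) x).det := by
    simp only [htel, Finset.mul_sum]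
    exact integral_finsetSum _ fun k _ => (hφ.continuous.mul (continuous_det_jacobianMatrix e
      (hsmooth k))).integrable_of_hasCompactSupport hφc.mul_right
  rw [hsum]
  refine (Finset.abs_sum_le_sum_abs _ _).trans ((Finset.sum_le_sum fun k _ => hterm k).trans ?_)
  rw [Finset.sum_const, Finset.card_univ, Fintype.card_fin, nsmul_eq_mul]
  refine (mul_le_mul_of_nonneg_left (mul_le_mul_of_nonneg_left hholder
    (mul_nonneg (Nat.cast_nonneg _) ENNReal.toReal_nonneg)) (Nat.cast_nonneg _)).trans_eq ?_
  ring
end
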